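/- arXiv:0905.0175 — 10 statements merged into one kernel-verified Lean document; each statement's English description precedes it below -/
import Mathlib

section
/- Let w ∈ ℝ, let k : ℝ → ℝ³ be differentiable, and let φ₀ ∈ ℝ satisfy k(φ₀)·k(φ₀) + w > 0 and k(φ₀)·k'(φ₀) ≠ 0. Define τ : ℝ → ℝ by τ(φ) = (1/2)·ln(k(φ)·k(φ) + w), and let ψ : ℝ → ℝ be differentiable at t₀ = τ(φ₀) with ψ(t₀) = φ₀ and ψ'(t₀) = 1/τ'(φ₀) (i.e. ψ is a local inverse of the reparametrization τ). Then for every vector n ∈ ℝ³, the vortex mode equation k'(φ₀)·(n − ((k(φ₀)·n)/(k(φ₀)·k(φ₀) + w))·k(φ₀)) = 0 holds if and only if the new form n·((k∘ψ)'(t₀) − k(φ₀)) = 0 holds. -/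
/-- Euclidean dot product on `ℝ³`. -/
noncomputable def dot3 (a b : Fin 3 → ℝ) : ℝ := ∑ i, a i * b i

theorem hasDerivAt_dot3_self {k : ℝ → Fin 3 → ℝ} {k' : Fin 3 → ℝ} {x : ℝ}
    (h : HasDerivAt k k' x) :
    HasDerivAt (fun y => dot3 (k y) (k y)) (2 * dot3 (k x) k') x := by
  have hi := hasDerivAt_pi.1 h
  simp only [dot3]
  refine (HasDerivAt.fun_sum fun i _ => (hi i).fun_mul (hi i)).congr_deriv ?_
  rw [Finset.mul_sum]
  exact Finset.sum_congr rfl fun i _ => by ring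

/-- The vortex mode equation `k'(φ₀)·(n − ((k(φ₀)·n)/(k(φ₀)·k(φ₀)+w))·k(φ₀)) = 0`
holds iff the new form `n·((k∘ψ)'(t₀) − k(φ₀)) = 0` holds, where
`τ(φ) = (1/2)·ln(k(φ)·k(φ)+w)` and `ψ` is a local inverse of `τ` at `t₀ = τ(φ₀)`. -/
theorem vortex_mode_new_form (w : ℝ) (k : ℝ → Fin 3 → ℝ) (hk : Differentiable ℝ k)
    (φ₀ : ℝ) (hw : dot3 (k φ₀) (k φ₀) + w > 0)
    (hkk' : dot3 (k φ₀) (deriv k φ₀) ≠ 0)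
    (τ : ℝ → ℝ) (hτ : ∀ φ, τ φ = (1 / 2) * Real.log (dot3 (k φ) (k φ) + w))
    (t₀ : ℝ) (ht₀ : t₀ = τ φ₀)
    (ψ : ℝ → ℝ) (hψd : DifferentiableAt ℝ ψ t₀) (hψ : ψ t₀ = φ₀)
    (hψ' : deriv ψ t₀ = 1 / deriv τ φ₀) :
    ∀ n : Fin 3 → ℝ,
      dot3 (deriv k φ₀)
          (n - (dot3 (k φ₀) n / (dot3 (k φ₀) (k φ₀) + w)) • k φ₀) = 0 ↔
      dot3 n (deriv (k ∘ ψ) t₀ - k φ₀) = 0 := by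
  intro n
  have hkd : HasDerivAt k (deriv k φ₀) φ₀ := (hk φ₀).hasDerivAt
  have hτd : deriv τ φ₀ =
      dot3 (k φ₀) (deriv k φ₀) / (dot3 (k φ₀) (k φ₀) + w) := by
    rw [funext hτ]
    refine ((((hasDerivAt_dot3_self hkd).add_const w).log hw.ne').const_mul
      (1 / 2 : ℝ)).deriv.trans ?_
    ring
  have hcomp : deriv (k ∘ ψ) t₀ = deriv ψ t₀ • deriv k φ₀ := by
    subst hψ
    exact (hkd.scomp t₀ hψd.hasDerivAt).deriv
  rw [hcomp, hψ', hτd, one_div_div]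
  generalize deriv k φ₀ = v at *
  generalize k φ₀ = u at *
  have hleft : ∀ c : ℝ, dot3 v (n - c • u) = dot3 n v - c * dot3 u v := by
    intro c
    simp only [dot3, Fin.sum_univ_three, Pi.sub_apply, Pi.smul_apply, smul_eq_mul]
    ring
  have hright : ∀ c : ℝ, dot3 n (c • v - u) = c * dot3 n v - dot3 u n := by
    intro c
    simp only [dot3, Fin.sum_univ_three, Pi.sub_apply, Pi.smul_apply, smul_eq_mul]
    ring
  have hs := hw.ne'
  rw [hleft, hright, sub_eq_zero, sub_eq_zero, div_mul_eq_mul_div, div_mul_eq_mul_div,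
    eq_div_iff hs, div_eq_iff hkk', mul_comm (dot3 n v)]
end

section
/- Let T : ℝ → ℝ and H : ℝ³ → ℝ be smooth. On ℝ¹³ with coordinates (t, k₁,k₂,k₃, n₁,n₂,n₃, q₁,q₂,q₃, p₁,p₂,p₃), define K₁(t,k,n) = k₁·T(t) + eᵗ·H(e⁻ᵗ·k), K₂(t,k,n) = k₂·T(t), K₃(t,k,n) = k₃·T(t), and Nᵢ(t,k,n) = nᵢ·(T'(t) − T(t)) − n₁·∂ᵢH(e⁻ᵗ·k) for i = 1,2,3, where ∂ᵢH denotes the i-th partial derivative of H. Define the first-prolongation coefficients Kᵢᵗ = ∂Kᵢ/∂t + Σⱼ qⱼ·∂Kᵢ/∂kⱼ + Σⱼ pⱼ·∂Kᵢ/∂nⱼ − qᵢ·T'(t). Then the identity Σᵢ₌₁³ [ nᵢ·(Kᵢᵗ − Kᵢ) + Nᵢ·(qᵢ − kᵢ) ] = 0 holds at every point (t,k,n,q,p) ∈ ℝ¹³. -/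
/-- The coefficients `K₁ = k₁·T(t) + eᵗ·H(e⁻ᵗ·k)`, `K₂ = k₂·T(t)`, `K₃ = k₃·T(t)`
(as functions of `(t, k, n)`; they do not depend on `n`). -/
noncomputable def Kcoef (T : ℝ → ℝ) (H : (Fin 3 → ℝ) → ℝ) (i : Fin 3)
    (t : ℝ) (k n : Fin 3 → ℝ) : ℝ :=
  k i * T t + (if i = 0 then Real.exp t * H (fun j => Real.exp (-t) * k j) else 0)

/-- The coefficients `Nᵢ = nᵢ·(T'(t) − T(t)) − n₁·∂ᵢH(e⁻ᵗ·k)`. -/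
noncomputable def Ncoef (T : ℝ → ℝ) (H : (Fin 3 → ℝ) → ℝ) (i : Fin 3)
    (t : ℝ) (k n : Fin 3 → ℝ) : ℝ :=
  n i * (deriv T t - T t)
    - n 0 * fderiv ℝ H (fun j => Real.exp (-t) * k j) (Pi.single i 1)

/-- First-prolongation coefficients
`Kᵢᵗ = ∂Kᵢ/∂t + Σⱼ qⱼ·∂Kᵢ/∂kⱼ + Σⱼ pⱼ·∂Kᵢ/∂nⱼ − qᵢ·T'(t)`. -/
noncomputable def Kprol (T : ℝ → ℝ) (H : (Fin 3 → ℝ) → ℝ) (i : Fin 3)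
    (t : ℝ) (k n q p : Fin 3 → ℝ) : ℝ :=
  deriv (fun s => Kcoef T H i s k n) t
    + ∑ j : Fin 3, q j * fderiv ℝ (fun k' => Kcoef T H i t k' n) k (Pi.single j 1)
    + ∑ j : Fin 3, p j * fderiv ℝ (fun n' => Kcoef T H i t k n') n (Pi.single j 1)
    - q i * deriv T t

theorem hasDerivAt_Kcoef_time {T : ℝ → ℝ} {H : (Fin 3 → ℝ) → ℝ}
    (hT : Differentiable ℝ T) (hH : Differentiable ℝ H) (i : Fin 3)
    (t : ℝ) (k n : Fin 3 → ℝ) :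
    HasDerivAt (fun s => Kcoef T H i s k n)
      (k i * deriv T t + if i = 0 then Real.exp t * H (fun j => Real.exp (-t) * k j)
        - fderiv ℝ H (fun j => Real.exp (-t) * k j) k else 0) t := by
  unfold Kcoef
  refine ((hT t).hasDerivAt.const_mul (k i)).add ?_
  split_ifs
  · have hscale : HasDerivAt (fun s : ℝ => fun j => Real.exp (-s) * k j)
        ((-Real.exp (-t)) • k) t := by
      rw [hasDerivAt_pi]
      intro j
      have h := ((hasDerivAt_neg t).exp).mul_const (k j)
      simpa using h
    have h := (Real.hasDerivAt_exp t).mul ((hH _).hasFDerivAt.comp_hasDerivAt t hscale)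
    refine h.congr_deriv ?_
    simp only [map_smul, smul_eq_mul, Function.comp_apply]
    have he : Real.exp t * Real.exp (-t) = 1 := by rw [← Real.exp_add]; simp
    linear_combination (-(fderiv ℝ H (fun j => Real.exp (-t) * k j) k)) * he
  · exact hasDerivAt_const t 0

theorem fderiv_Kcoef_space {T : ℝ → ℝ} {H : (Fin 3 → ℝ) → ℝ}
    (hH : Differentiable ℝ H) (i : Fin 3) (t : ℝ) (k n v : Fin 3 → ℝ) :
    fderiv ℝ (fun k' => Kcoef T H i t k' n) k v =
      v i * T t + if i = 0 then fderiv ℝ H (fun j => Real.exp (-t) * k j) v else 0 := by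
  unfold Kcoef
  have hlin : HasFDerivAt (fun k' : Fin 3 → ℝ => k' i * T t)
      (T t • ContinuousLinearMap.proj (R := ℝ) (φ := fun _ : Fin 3 => ℝ) i) k :=
    (hasFDerivAt_apply i k).mul_const (T t)
  split_ifs
  · have hscale : HasFDerivAt (fun k' : Fin 3 → ℝ => fun j => Real.exp (-t) * k' j)
        (Real.exp (-t) • ContinuousLinearMap.id ℝ (Fin 3 → ℝ)) k :=
      (hasFDerivAt_id k).const_smul (Real.exp (-t))
    have h : HasFDerivAt
        (fun k' : Fin 3 → ℝ => Real.exp t * H (fun j => Real.exp (-t) * k' j)) _ k :=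
      ((hH _).hasFDerivAt.comp k hscale).const_mul (Real.exp t)
    rw [(hlin.fun_add h).fderiv]
    have he : Real.exp t * Real.exp (-t) = 1 := by rw [← Real.exp_add]; simp
    simp [mul_comm (T t), ← mul_assoc, he]
  · simp only [add_zero]
    rw [hlin.fderiv]
    simp [mul_comm]

theorem ContinuousLinearMap.apply_eq_sum_single {ι : Type*} [Fintype ι] [DecidableEq ι]
    (L : (ι → ℝ) →L[ℝ] ℝ) (v : ι → ℝ) :
    L v = ∑ j, v j * L (Pi.single j 1) := by
  conv_lhs => rw [pi_eq_sum_univ' v]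
  simp [map_sum]

theorem Kprol_eq {T : ℝ → ℝ} {H : (Fin 3 → ℝ) → ℝ}
    (hT : Differentiable ℝ T) (hH : Differentiable ℝ H) (i : Fin 3)
    (t : ℝ) (k n q p : Fin 3 → ℝ) :
    Kprol T H i t k n q p = Kcoef T H i t k n + (q i - k i) * (T t - deriv T t)
      + if i = 0 then fderiv ℝ H (fun j => Real.exp (-t) * k j) (q - k) else 0 := by
  have hn : fderiv ℝ (fun n' => Kcoef T H i t k n') n = 0 := by
    simp [Kcoef]
  unfold Kprol
  rw [(hasDerivAt_Kcoef_time hT hH i t k n).deriv, hn,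
    ← ContinuousLinearMap.apply_eq_sum_single, fderiv_Kcoef_space hH]
  unfold Kcoef
  split_ifs <;> simp only [map_sub, zero_apply, mul_zero,
    Finset.sum_const_zero] <;> ring

/-- The prolongation identity `Σᵢ [ nᵢ·(Kᵢᵗ − Kᵢ) + Nᵢ·(qᵢ − kᵢ) ] = 0`
holds at every point `(t, k, n, q, p) ∈ ℝ¹³`. -/
theorem prolongation_identity (T : ℝ → ℝ) (H : (Fin 3 → ℝ) → ℝ)
    (hT : ContDiff ℝ (⊤ : ℕ∞) T) (hH : ContDiff ℝ (⊤ : ℕ∞) H) :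
    ∀ (t : ℝ) (k n q p : Fin 3 → ℝ),
      ∑ i : Fin 3,
        (n i * (Kprol T H i t k n q p - Kcoef T H i t k n)
          + Ncoef T H i t k n * (q i - k i)) = 0 := by
  intro t k n q p
  have hT' : Differentiable ℝ T := hT.differentiable (by simp)
  have hH' : Differentiable ℝ H := hH.differentiable (by simp)
  simp only [Kprol_eq hT' hH', Ncoef]
  rw [ContinuousLinearMap.apply_eq_sum_single _ (q - k)]
  simp only [Fin.sum_univ_three, Pi.sub_apply, if_true, one_ne_zero, if_false,
    show (2 : Fin 3) ≠ 0 by decide]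
  ring
end

section
/- Let T : ℝ → ℝ and H : ℝ³ → ℝ be smooth. On ℝ⁷ with coordinates (t, k₁,k₂,k₃, n₁,n₂,n₃), define K₁(t,k,n) = k₁·T(t) + eᵗ·H(e⁻ᵗ·k), K₂(t,k,n) = k₂·T(t), K₃(t,k,n) = k₃·T(t), and Nᵢ(t,k,n) = nᵢ·(T'(t) − T(t)) − n₁·∂ᵢH(e⁻ᵗ·k). Then the determining equations Nᵢ − nᵢ·T'(t) + Σⱼ₌₁³ nⱼ·(∂Kⱼ/∂kᵢ) = 0 hold identically on ℝ⁷ for each i = 1,2,3. -/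
/-- The partial derivative of `Kⱼ` with respect to `kᵢ`. -/
theorem fderiv_Kcoef_single (T : ℝ → ℝ) {H : (Fin 3 → ℝ) → ℝ} (hH : Differentiable ℝ H)
    (i j : Fin 3) (t : ℝ) (k n : Fin 3 → ℝ) :
    fderiv ℝ (fun k' => Kcoef T H j t k' n) k (Pi.single i 1) =
      (if j = i then T t else 0) +
        (if j = 0 then fderiv ℝ H (fun l => Real.exp (-t) * k l) (Pi.single i 1) else 0) := by
  have hlin : HasFDerivAt (fun k' : Fin 3 → ℝ => k' j * T t)
      (T t • ContinuousLinearMap.proj (R := ℝ) (φ := fun _ : Fin 3 => ℝ) j) k :=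
    (hasFDerivAt_apply j k).mul_const (T t)
  have hscale : HasFDerivAt (fun k' : Fin 3 → ℝ => Real.exp (-t) • k')
      (Real.exp (-t) • ContinuousLinearMap.id ℝ (Fin 3 → ℝ)) k :=
    (hasFDerivAt_id k).const_smul (Real.exp (-t))
  have hcomp := ((hH (Real.exp (-t) • k)).hasFDerivAt.comp k hscale).const_mul (Real.exp t)
  by_cases hj : j = 0
  · have hK : HasFDerivAt (fun k' => Kcoef T H j t k' n) _ k :=
      (hlin.add hcomp).congr_of_eventuallyEq (.of_forall fun k' => by
        simp only [Kcoef, if_pos hj]; rfl)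
    have hexp : Real.exp t * Real.exp (-t) = 1 := by rw [← Real.exp_add]; simp
    rw [hK.fderiv, if_pos hj]
    simp [Pi.single_apply, ← mul_assoc, hexp]
    rfl
  · have hK : HasFDerivAt (fun k' => Kcoef T H j t k' n) _ k :=
      hlin.congr_of_eventuallyEq (.of_forall fun k' => by simp [Kcoef, if_neg hj])
    rw [hK.fderiv, if_neg hj]
    simp [Pi.single_apply]

/-- The determining equations `Nᵢ − nᵢ·T'(t) + Σⱼ nⱼ·(∂Kⱼ/∂kᵢ) = 0` hold
identically on `ℝ⁷` for each `i = 1, 2, 3`. -/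
theorem determining_equations_first (T : ℝ → ℝ) (H : (Fin 3 → ℝ) → ℝ)
    (hT : ContDiff ℝ (⊤ : ℕ∞) T) (hH : ContDiff ℝ (⊤ : ℕ∞) H) :
    ∀ (i : Fin 3) (t : ℝ) (k n : Fin 3 → ℝ),
      Ncoef T H i t k n - n i * deriv T t
        + ∑ j : Fin 3,
            n j * fderiv ℝ (fun k' => Kcoef T H j t k' n) k (Pi.single i 1) = 0 := by
  intro i t k n
  simp only [fderiv_Kcoef_single T (hH.differentiable (by simp)), Ncoef, mul_add,
    Finset.sum_add_distrib, mul_ite, mul_zero, Finset.sum_ite_eq', Finset.mem_univ, if_true]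
  ring
end

section
/- Let T : ℝ → ℝ and H : ℝ³ → ℝ be smooth. On ℝ⁷ with coordinates (t, k₁,k₂,k₃, n₁,n₂,n₃), define K₁(t,k,n) = k₁·T(t) + eᵗ·H(e⁻ᵗ·k), K₂(t,k,n) = k₂·T(t), K₃(t,k,n) = k₃·T(t), and Nᵢ(t,k,n) = nᵢ·(T'(t) − T(t)) − n₁·∂ᵢH(e⁻ᵗ·k). Then the determining equation Σᵢ₌₁³ [ nᵢ·(∂Kᵢ/∂t − Kᵢ) − Nᵢ·kᵢ ] = 0 holds identically on ℝ⁷. -/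
/-- Along a curve `s ↦ e⁻ˢ·k`, the rescaled function `eˢ·H(e⁻ˢ·k)` has derivative
`eᵗ·H(e⁻ᵗ·k) − Σⱼ kⱼ·∂ⱼH(e⁻ᵗ·k)`. -/
theorem hasDerivAt_exp_mul_comp_exp_neg_smul {ι : Type*} [Fintype ι] [DecidableEq ι]
    {H : (ι → ℝ) → ℝ} {t : ℝ} {k : ι → ℝ}
    (hH : DifferentiableAt ℝ H (fun j => Real.exp (-t) * k j)) :
    HasDerivAt (fun s => Real.exp s * H (fun j => Real.exp (-s) * k j))
      (Real.exp t * H (fun j => Real.exp (-t) * k j)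
        - ∑ j, k j * fderiv ℝ H (fun j => Real.exp (-t) * k j) (Pi.single j 1)) t := by
  have hcurve : HasDerivAt (fun s => fun j => Real.exp (-s) * k j)
      (-Real.exp (-t) • k) t := by
    refine hasDerivAt_pi.2 fun j => ?_
    simpa using ((hasDerivAt_neg t).exp).mul_const (k j)
  have hcomp := hH.hasFDerivAt.comp_hasDerivAt t hcurve
  refine ((Real.hasDerivAt_exp t).mul hcomp).congr_deriv ?_
  have hexp : Real.exp t * Real.exp (-t) = 1 := by
    rw [← Real.exp_add, add_neg_cancel, Real.exp_zero]
  have hsum : ∑ j, k j * fderiv ℝ H (fun j => Real.exp (-t) * k j) (Pi.single j 1)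
      = fderiv ℝ H (fun j => Real.exp (-t) * k j) k := by
    conv_rhs => rw [pi_eq_sum_univ' k]
    simp only [map_sum, map_smul, smul_eq_mul]
    refine Finset.sum_congr rfl fun j _ => ?_
    congr 2
    ext i
    simp [Pi.single_apply]
  rw [hsum, map_smul, smul_eq_mul]
  simp only [Function.comp_apply]
  linear_combination (-fderiv ℝ H (fun j => Real.exp (-t) * k j) k) * hexp

/-- The determining equation `Σᵢ [ nᵢ·(∂Kᵢ/∂t − Kᵢ) − Nᵢ·kᵢ ] = 0` holds
identically on `ℝ⁷`. -/
theorem determining_equation_sum (T : ℝ → ℝ) (H : (Fin 3 → ℝ) → ℝ)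
    (hT : ContDiff ℝ (⊤ : ℕ∞) T) (hH : ContDiff ℝ (⊤ : ℕ∞) H) :
    ∀ (t : ℝ) (k n : Fin 3 → ℝ),
      ∑ i : Fin 3,
        (n i * (deriv (fun s => Kcoef T H i s k n) t - Kcoef T H i t k n)
          - Ncoef T H i t k n * k i) = 0 := by
  intro t k n
  have hT' : HasDerivAt T (deriv T t) t := (hT.differentiable (by simp) t).hasDerivAt
  have hH' := hasDerivAt_exp_mul_comp_exp_neg_smul (t := t) (k := k)
    (hH.differentiable (by simp) _)
  have hK : ∀ i, deriv (fun s => Kcoef T H i s k n) t = k i * deriv T t +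
      if i = 0 then Real.exp t * H (fun j => Real.exp (-t) * k j)
        - ∑ j, k j * fderiv ℝ H (fun j => Real.exp (-t) * k j) (Pi.single j 1) else 0 := by
    intro i
    by_cases hi : i = 0
    · simpa only [Kcoef, hi, if_true] using ((hT'.const_mul (k 0)).fun_add hH').deriv
    · simpa only [Kcoef, hi, if_false, add_zero] using (hT'.const_mul (k i)).deriv
  simp only [hK]
  simp only [Kcoef, Ncoef, Fin.sum_univ_three, if_true, one_ne_zero, if_false,
    show (2 : Fin 3) ≠ 0 by decide]
  ring
end

section
/- Let T : ℝ → ℝ and H : ℝ³ → ℝ be smooth. On ℝ⁷ with coordinates (t, k₁,k₂,k₃, n₁,n₂,n₃), define the vector fields v_T(t,k,n) = ( T(t), T(t)·k₁, T(t)·k₂, T(t)·k₃, (T'(t)−T(t))·n₁, (T'(t)−T(t))·n₂, (T'(t)−T(t))·n₃ ) and v_H(t,k,n) = ( 0, eᵗ·H(e⁻ᵗ·k), 0, 0, −n₁·∂₁H(e⁻ᵗ·k), −n₁·∂₂H(e⁻ᵗ·k), −n₁·∂₃H(e⁻ᵗ·k) ). Then the Lie bracket of v_T and v_H vanishes identically: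 [v_T, v_H] = 0 at every point of ℝ⁷. -/
/-- `ℝ⁷` with coordinates `(t, k₁,k₂,k₃, n₁,n₂,n₃)`. -/
abbrev Space7 : Type := ℝ × (Fin 3 → ℝ) × (Fin 3 → ℝ)

/-- The vector field
`v_T = ( T(t), T(t)·k₁, T(t)·k₂, T(t)·k₃, (T'−T)·n₁, (T'−T)·n₂, (T'−T)·n₃ )`. -/
noncomputable def vT (T : ℝ → ℝ) (x : Space7) : Space7 :=
  (T x.1, fun i => T x.1 * x.2.1 i, fun i => (deriv T x.1 - T x.1) * x.2.2 i)

/-- The vector field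
`v_H = ( 0, eᵗ·H(e⁻ᵗ·k), 0, 0, −n₁·∂₁H(e⁻ᵗ·k), −n₁·∂₂H(e⁻ᵗ·k), −n₁·∂₃H(e⁻ᵗ·k) )`. -/
noncomputable def vH (H : (Fin 3 → ℝ) → ℝ) (x : Space7) : Space7 :=
  (0,
   fun i => if i = 0 then Real.exp x.1 * H (fun j => Real.exp (-x.1) * x.2.1 j) else 0,
   fun i => -x.2.2 0 * fderiv ℝ H (fun j => Real.exp (-x.1) * x.2.1 j) (Pi.single i 1))

/-- The similarity variable `e⁻ᵗ·k` on `ℝ⁷`. -/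
noncomputable def scaledWave (x : Space7) : Fin 3 → ℝ :=
  fun j => Real.exp (-x.1) * x.2.1 j

lemma hasFDerivAt_time (x : Space7) :
    HasFDerivAt (fun y : Space7 => y.1) (ContinuousLinearMap.fst ℝ ℝ _) x :=
  hasFDerivAt_fst

lemma hasFDerivAt_wave (x : Space7) (i : Fin 3) :
    HasFDerivAt (fun y : Space7 => y.2.1 i)
      ((ContinuousLinearMap.proj (R := ℝ) (φ := fun _ : Fin 3 => ℝ) i).comp
        ((ContinuousLinearMap.fst ℝ _ _).comp (ContinuousLinearMap.snd ℝ ℝ _))) x :=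
  hasFDerivAt_pi'.1 (HasFDerivAt.fst hasFDerivAt_snd) i

lemma hasFDerivAt_normal (x : Space7) (i : Fin 3) :
    HasFDerivAt (fun y : Space7 => y.2.2 i)
      ((ContinuousLinearMap.proj (R := ℝ) (φ := fun _ : Fin 3 => ℝ) i).comp
        ((ContinuousLinearMap.snd ℝ _ _).comp (ContinuousLinearMap.snd ℝ ℝ _))) x :=
  hasFDerivAt_pi'.1 (HasFDerivAt.snd hasFDerivAt_snd) i

lemma differentiable_scaledWave : Differentiable ℝ scaledWave := by
  unfold scaledWave
  fun_prop

/-- `e⁻ᵗ·k` is invariant under the flow of `v_T`. -/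
lemma fderiv_scaledWave_vT (T : ℝ → ℝ) (x : Space7) :
    fderiv ℝ scaledWave x (vT T x) = 0 := by
  have h : HasFDerivAt scaledWave _ x := hasFDerivAt_pi.2 fun j =>
    (hasFDerivAt_time x).neg.exp.mul (hasFDerivAt_wave x j)
  rw [h.fderiv]
  ext j
  simp [vT]
  ring

lemma fderiv_comp_scaledWave_vT (T : ℝ → ℝ) {G : (Fin 3 → ℝ) → ℝ} (hG : Differentiable ℝ G)
    (x : Space7) : fderiv ℝ (fun y => G (scaledWave y)) x (vT T x) = 0 := by
  have h := fderiv_comp x (hG (scaledWave x)) (differentiable_scaledWave x)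
  change fderiv ℝ (G ∘ scaledWave) x (vT T x) = 0
  simp [h, fderiv_scaledWave_vT]

lemma fderiv_vT_apply {T : ℝ → ℝ} (hT : Differentiable ℝ T) (hT' : Differentiable ℝ (deriv T))
    (x v : Space7) (hv : v.1 = 0) :
    fderiv ℝ (vT T) x v =
      (0, fun i => T x.1 * v.2.1 i, fun i => (deriv T x.1 - T x.1) * v.2.2 i) := by
  have hT₁ := (hT x.1).hasDerivAt.comp_hasFDerivAt x (hasFDerivAt_time x)
  have hT₂ := (hT' x.1).hasDerivAt.comp_hasFDerivAt x (hasFDerivAt_time x)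
  have h : HasFDerivAt (vT T) _ x := hT₁.prodMk
    ((hasFDerivAt_pi.2 fun i => hT₁.mul (hasFDerivAt_wave x i)).prodMk
      (hasFDerivAt_pi.2 fun i => (hT₂.sub hT₁).mul (hasFDerivAt_normal x i)))
  rw [h.fderiv]
  ext i <;> simp [hv]

lemma fderiv_vH_vT (T : ℝ → ℝ) {H : (Fin 3 → ℝ) → ℝ} (hH : Differentiable ℝ H)
    (hH' : Differentiable ℝ (fderiv ℝ H)) (x : Space7) :
    fderiv ℝ (vH H) x (vT T x) =
      (0, fun i => T x.1 * (vH H x).2.1 i,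
        fun i => (deriv T x.1 - T x.1) * (vH H x).2.2 i) := by
  have hwave (i : Fin 3) : ∃ L : Space7 →L[ℝ] ℝ,
      HasFDerivAt (fun y => (vH H y).2.1 i) L x ∧ L (vT T x) = T x.1 * (vH H x).2.1 i := by
    by_cases hi : i = 0
    · have hG : Differentiable ℝ fun y => H (scaledWave y) := hH.comp differentiable_scaledWave
      have h := (hasFDerivAt_time x).exp.mul (hG x).hasFDerivAt
      subst hi
      refine ⟨_, h, ?_⟩
      have htime : (vT T x).1 = T x.1 := rfl
      have hvalue : (vH H x).2.1 0 = Real.exp x.1 * H (scaledWave x) := rfl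
      simp [fderiv_comp_scaledWave_vT T hH, htime, hvalue]
      ring
    · exact ⟨0, by simpa [vH, hi] using hasFDerivAt_const (0 : ℝ) x, by simp [vH, hi]⟩
  have hnormal (i : Fin 3) : ∃ L : Space7 →L[ℝ] ℝ,
      HasFDerivAt (fun y => (vH H y).2.2 i) L x ∧
        L (vT T x) = (deriv T x.1 - T x.1) * (vH H x).2.2 i := by
    have hD : Differentiable ℝ fun z => fderiv ℝ H z (Pi.single i 1) := by fun_prop
    have hG : Differentiable ℝ fun y => fderiv ℝ H (scaledWave y) (Pi.single i 1) :=
      hD.comp differentiable_scaledWave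
    have h := (hasFDerivAt_normal x 0).neg.mul (hG x).hasFDerivAt
    refine ⟨_, h, ?_⟩
    have hfirst : (vT T x).2.2 0 = (deriv T x.1 - T x.1) * x.2.2 0 := rfl
    have hvalue : (vH H x).2.2 i =
        -x.2.2 0 * fderiv ℝ H (scaledWave x) (Pi.single i 1) := rfl
    simp [fderiv_comp_scaledWave_vT T hD, hfirst, hvalue]
    ring
  choose L hL hLv using hwave
  choose M hM hMv using hnormal
  have h : HasFDerivAt (vH H) _ x := (hasFDerivAt_const (0 : ℝ) x).prodMk
    ((hasFDerivAt_pi.2 hL).prodMk (hasFDerivAt_pi.2 hM))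
  rw [h.fderiv]
  ext i <;> simp [hLv, hMv]

/-- The Lie bracket `[v_T, v_H](x) = DvH(x)[vT(x)] − DvT(x)[vH(x)]` vanishes
identically on `ℝ⁷`. -/
theorem bracket_vT_vH_vanishes (T : ℝ → ℝ) (H : (Fin 3 → ℝ) → ℝ)
    (hT : ContDiff ℝ (⊤ : ℕ∞) T) (hH : ContDiff ℝ (⊤ : ℕ∞) H) :
    ∀ x : Space7,
      fderiv ℝ (vH H) x (vT T x) - fderiv ℝ (vT T) x (vH H x) = 0 := by
  intro x
  have hT' : Differentiable ℝ (deriv T) :=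
    (contDiff_infty_iff_deriv.1 hT).2.differentiable (by simp)
  have hH' : Differentiable ℝ (fderiv ℝ H) :=
    (contDiff_infty_iff_fderiv.1 hH).2.differentiable (by simp)
  rw [fderiv_vH_vT T (hH.differentiable (by simp)) hH',
    fderiv_vT_apply (hT.differentiable (by simp)) hT' x (vH H x) rfl, sub_self]
end

section
/- Let T : ℝ → ℝ and H : ℝ³ → ℝ be smooth, and let v be the vector field on ℝ⁷ with components ( T(t), k₁·T(t) + eᵗ·H(e⁻ᵗ·k), k₂·T(t), k₃·T(t), N₁, N₂, N₃ ) where Nᵢ = nᵢ·(T'(t) − T(t)) − n₁·∂ᵢH(e⁻ᵗ·k). Then on the region where k₂ > 0 and k₃ > 0, the functions I₂(t,k,n) = ln(k₂) − t and I₃(t,k,n) = ln(k₃) − t are invariants of v, i.e. the directional derivative of I₂ and of I₃ along v vanishes at every such point. -/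
/-- The general point infinitesimal generator, with components
`( T(t), k₁·T(t) + eᵗ·H(e⁻ᵗ·k), k₂·T(t), k₃·T(t), N₁, N₂, N₃ )`
where `Nᵢ = nᵢ·(T'(t) − T(t)) − n₁·∂ᵢH(e⁻ᵗ·k)`. -/
noncomputable def vGen (T : ℝ → ℝ) (H : (Fin 3 → ℝ) → ℝ) (x : Space7) : Space7 :=
  (T x.1,
   fun i => x.2.1 i * T x.1 +
     (if i = 0 then Real.exp x.1 * H (fun j => Real.exp (-x.1) * x.2.1 j) else 0),
   fun i => x.2.2 i * (deriv T x.1 - T x.1)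
     - x.2.2 0 * fderiv ℝ H (fun j => Real.exp (-x.1) * x.2.1 j) (Pi.single i 1))

/-- The coordinate `kᵢ` as a continuous linear functional. -/
noncomputable def kCoord (i : Fin 3) : Space7 →L[ℝ] ℝ :=
  (ContinuousLinearMap.proj (R := ℝ) (φ := fun _ : Fin 3 => ℝ) i).comp
    ((ContinuousLinearMap.fst ℝ (Fin 3 → ℝ) (Fin 3 → ℝ)).comp
      (ContinuousLinearMap.snd ℝ ℝ ((Fin 3 → ℝ) × (Fin 3 → ℝ))))

theorem kCoord_apply (i : Fin 3) (x : Space7) : kCoord i x = x.2.1 i := rfl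

theorem hasFDerivAt_log_coord_sub_time (i : Fin 3) (x : Space7) (hx : x.2.1 i ≠ 0) :
    HasFDerivAt (fun y : Space7 => Real.log (y.2.1 i) - y.1)
      ((x.2.1 i)⁻¹ • kCoord i - ContinuousLinearMap.fst ℝ ℝ ((Fin 3 → ℝ) × (Fin 3 → ℝ))) x :=
  HasFDerivAt.sub (HasFDerivAt.log (f := fun y : Space7 => y.2.1 i) (kCoord i).hasFDerivAt hx)
    hasFDerivAt_fst

theorem fderiv_log_coord_sub_time_vGen (T : ℝ → ℝ) (H : (Fin 3 → ℝ) → ℝ) {i : Fin 3}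
    (hi : i ≠ 0) (x : Space7) (hx : x.2.1 i ≠ 0) :
    fderiv ℝ (fun y : Space7 => Real.log (y.2.1 i) - y.1) x (vGen T H x) = 0 := by
  rw [(hasFDerivAt_log_coord_sub_time i x hx).fderiv]
  simp [kCoord_apply, vGen, hi, hx]

/-- On the region `k₂ > 0`, `k₃ > 0`, the functions `I₂ = ln(k₂) − t` and
`I₃ = ln(k₃) − t` are invariants of the general point infinitesimal generator:
their directional derivatives along `v` vanish. -/
theorem invariants_I2_I3 (T : ℝ → ℝ) (H : (Fin 3 → ℝ) → ℝ)
    (hT : ContDiff ℝ (⊤ : ℕ∞) T) (hH : ContDiff ℝ (⊤ : ℕ∞) H) :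
    ∀ x : Space7, 0 < x.2.1 1 → 0 < x.2.1 2 →
      fderiv ℝ (fun y : Space7 => Real.log (y.2.1 1) - y.1) x (vGen T H x) = 0 ∧
      fderiv ℝ (fun y : Space7 => Real.log (y.2.1 2) - y.1) x (vGen T H x) = 0 :=
  fun x h₂ h₃ => ⟨fderiv_log_coord_sub_time_vGen T H (by decide) x h₂.ne',
    fderiv_log_coord_sub_time_vGen T H (by decide) x h₃.ne'⟩
end

section
/- Let k, n : ℝ → ℝ³ with k differentiable, and suppose n(t)·(k'(t) − k(t)) = 0 for all t ∈ ℝ. Then for every s ∈ ℝ, the transformed curves k̃(t) = eˢ·k(t−s) and ñ(t) = e⁻ˢ·n(t−s) also satisfy ñ(t)·(k̃'(t) − k̃(t)) = 0 for all t ∈ ℝ. In other words, the point transformation (t,k,n) ↦ (t+s, eˢk, e⁻ˢn) maps solutions of the equation to solutions. -/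
/-- If `k, n : ℝ → ℝ³` with `k` differentiable satisfy the new form of the
vortex mode equation `n(t)·(k'(t) − k(t)) = 0` for all `t`, then for every
`s ∈ ℝ` the transformed curves `k̃(t) = eˢ·k(t−s)` and `ñ(t) = e⁻ˢ·n(t−s)`
also satisfy `ñ(t)·(k̃'(t) − k̃(t)) = 0` for all `t`. -/
theorem point_transformation_v1_maps_solutions_to_solutions
    (k n : ℝ → Fin 3 → ℝ) (hk : Differentiable ℝ k)
    (h : ∀ t : ℝ, ∑ i : Fin 3, n t i * (deriv k t i - k t i) = 0)
    (s : ℝ) :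
    ∀ t : ℝ,
      ∑ i : Fin 3,
        (Real.exp (-s) • n (t - s)) i *
          (deriv (fun u => Real.exp s • k (u - s)) t i
            - (Real.exp s • k (t - s)) i) = 0 := by
  intro t
  have hderiv : deriv (fun u => Real.exp s • k (u - s)) t = Real.exp s • deriv k (t - s) :=
    ((hk (t - s)).hasDerivAt.comp_sub_const t s |>.const_smul (Real.exp s)).deriv
  have hexp : Real.exp (-s) * Real.exp s = 1 := by
    rw [← Real.exp_add, neg_add_cancel, Real.exp_zero]
  rw [hderiv, ← h (t - s)]
  refine Finset.sum_congr rfl fun i _ => ?_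
  simp only [Pi.smul_apply, smul_eq_mul]
  linear_combination (n (t - s) i * (deriv k (t - s) i - k (t - s) i)) * hexp
end

section
/- Let v₂ be the vector field on ℝ⁷ given by v₂(t,k,n) = (t, t·k₁, t·k₂, t·k₃, (1−t)·n₁, (1−t)·n₂, (1−t)·n₃), and for s ∈ ℝ define Ψ_s(t,k,n) = ( t·eˢ, k·e^{t(eˢ−1)}, n·e^{s−t(eˢ−1)} ). Then Ψ₀ is the identity and for every x ∈ ℝ⁷ and s ∈ ℝ, (d/ds)Ψ_s(x) = v₂(Ψ_s(x)); that is, Ψ is the flow of v₂. -/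
/-- The vector field
`v₂(t,k,n) = (t, t·k₁, t·k₂, t·k₃, (1−t)·n₁, (1−t)·n₂, (1−t)·n₃)`. -/
noncomputable def v2 (x : Space7) : Space7 :=
  (x.1, fun i => x.1 * x.2.1 i, fun i => (1 - x.1) * x.2.2 i)

/-- The one-parameter family
`Ψ_s(t,k,n) = (t·eˢ, k·e^{t(eˢ−1)}, n·e^{s−t(eˢ−1)})`. -/
noncomputable def Psi (s : ℝ) (x : Space7) : Space7 :=
  (x.1 * Real.exp s,
   fun i => x.2.1 i * Real.exp (x.1 * (Real.exp s - 1)),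
   fun i => x.2.2 i * Real.exp (s - x.1 * (Real.exp s - 1)))

theorem hasDerivAt_Psi (x : Space7) (s : ℝ) :
    HasDerivAt (fun s' => Psi s' x) (v2 (Psi s x)) s := by
  have hexp : HasDerivAt (fun s' => x.1 * (Real.exp s' - 1)) (x.1 * Real.exp s) s :=
    ((Real.hasDerivAt_exp s).sub_const 1).const_mul x.1
  refine ((Real.hasDerivAt_exp s).const_mul x.1).prodMk
    (HasDerivAt.prodMk (hasDerivAt_pi.2 fun i => ?_) (hasDerivAt_pi.2 fun i => ?_))
  · refine (hexp.exp.const_mul (x.2.1 i)).congr_deriv ?_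
    simp only [Psi]
    ring
  · refine (((hasDerivAt_id' s).sub hexp).exp.const_mul (x.2.2 i)).congr_deriv ?_
    simp only [Psi, Pi.sub_apply]
    ring

/-- `Ψ₀` is the identity and `(d/ds)Ψ_s(x) = v₂(Ψ_s(x))`; that is, `Ψ` is the
flow of `v₂`. -/
theorem Psi_is_flow_of_v2 :
    (∀ x : Space7, Psi 0 x = x) ∧
    (∀ (x : Space7) (s : ℝ), deriv (fun s' => Psi s' x) s = v2 (Psi s x)) := by
  exact ⟨fun x => by simp [Psi], fun x s => (hasDerivAt_Psi x s).deriv⟩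
end

section
/- Let k, n : ℝ → ℝ³ with k differentiable, and suppose n(t)·(k'(t) − k(t)) = 0 for all t ∈ ℝ. Fix s ∈ ℝ and define the transformed curves k̃(t) = k(e⁻ˢ·t)·e^{e⁻ˢt(eˢ−1)} and ñ(t) = n(e⁻ˢ·t)·e^{s−e⁻ˢt(eˢ−1)}. Then ñ(t)·(k̃'(t) − k̃(t)) = 0 for all t ∈ ℝ. In other words, the point transformation (t,k,n) ↦ (teˢ, k·e^{t(eˢ−1)}, n·e^{s−t(eˢ−1)}) maps solutions of the equation to solutions. -/
/-- If `k, n : ℝ → ℝ³` with `k` differentiable satisfy the new form of the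
vortex mode equation `n(t)·(k'(t) − k(t)) = 0` for all `t`, then for every
`s ∈ ℝ` the transformed curves `k̃(t) = k(e⁻ˢt)·e^{e⁻ˢt(eˢ−1)}` and
`ñ(t) = n(e⁻ˢt)·e^{s−e⁻ˢt(eˢ−1)}` also satisfy `ñ(t)·(k̃'(t) − k̃(t)) = 0`
for all `t`; i.e. the point transformation
`(t,k,n) ↦ (teˢ, k·e^{t(eˢ−1)}, n·e^{s−t(eˢ−1)})` maps solutions to solutions. -/
theorem point_transformation_v2_maps_solutions_to_solutions
    (k n : ℝ → Fin 3 → ℝ) (hk : Differentiable ℝ k)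
    (h : ∀ t : ℝ, ∑ i : Fin 3, n t i * (deriv k t i - k t i) = 0)
    (s : ℝ) :
    ∀ t : ℝ,
      ∑ i : Fin 3,
        (Real.exp (s - Real.exp (-s) * t * (Real.exp s - 1)) •
            n (Real.exp (-s) * t)) i *
          (deriv (fun u =>
              Real.exp (Real.exp (-s) * u * (Real.exp s - 1)) •
                k (Real.exp (-s) * u)) t i
            - (Real.exp (Real.exp (-s) * t * (Real.exp s - 1)) •
                k (Real.exp (-s) * t)) i) = 0 := by
  intro t
  have hlin : HasDerivAt (fun u : ℝ => Real.exp (-s) * u) (Real.exp (-s)) t := by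
    simpa using (hasDerivAt_id t).const_mul (Real.exp (-s))
  have hexp := (hlin.mul_const (Real.exp s - 1)).exp
  have hcomp : HasDerivAt (fun u : ℝ => k (Real.exp (-s) * u))
      (Real.exp (-s) • deriv k (Real.exp (-s) * t)) t :=
    (hk (Real.exp (-s) * t)).hasDerivAt.scomp t hlin
  have hderiv := (hexp.smul hcomp).deriv
  have hinv : Real.exp (-s) * Real.exp s = 1 := by
    rw [← Real.exp_add, neg_add_cancel, Real.exp_zero]
  change deriv (fun u => Real.exp (Real.exp (-s) * u * (Real.exp s - 1)) •
    k (Real.exp (-s) * u)) t = _ at hderiv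
  rw [hderiv]
  set c := Real.exp (s - Real.exp (-s) * t * (Real.exp s - 1))
  set g := Real.exp (Real.exp (-s) * t * (Real.exp s - 1))
  rw [← mul_zero (c * g * Real.exp (-s)), ← h (Real.exp (-s) * t), Finset.mul_sum]
  refine Finset.sum_congr rfl fun i _ => ?_
  simp only [Pi.smul_apply, Pi.add_apply, smul_eq_mul]
  linear_combination c * n (Real.exp (-s) * t) i * g * k (Real.exp (-s) * t) i * hinv
end

section
/- Let μ : ℝ⁶ → ℝ be differentiable and define, on the region of ℝ⁷ where t > 0, all kᵢ > 0 and all nⱼ > 0, the function S(t,k,n) = μ( ln(k₁)−t, ln(k₂)−t, ln(k₃)−t, ln(n₁/t)+t, ln(n₂/t)+t, ln(n₃/t)+t ). Then S satisfies v₂[S] = 0 at every such point, where v₂ is the vector field v₂(t,k,n) = (t, t·k₁, t·k₂, t·k₃, (1−t)·n₁, (1−t)·n₂, (1−t)·n₃) on ℝ⁷. -/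
/-- The invariant `ln kᵢ − t` is annihilated by `v2`. -/
theorem exists_hasFDerivAt_log_sub {x : Space7} {i : Fin 3} (hk : 0 < x.2.1 i) :
    ∃ L : Space7 →L[ℝ] ℝ,
      HasFDerivAt (fun y : Space7 => Real.log (y.2.1 i) - y.1) L x ∧ L (v2 x) = 0 := by
  have ht : HasFDerivAt (fun y : Space7 => y.1) (ContinuousLinearMap.fst ℝ _ _) x :=
    hasFDerivAt_fst
  have hki : HasFDerivAt (fun y : Space7 => y.2.1 i) _ x :=
    hasFDerivAt_pi'.1 (hasFDerivAt_snd (𝕜 := ℝ) (p := x)).fst i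
  refine ⟨_, (hki.log hk.ne').sub ht, ?_⟩
  have := hk.ne'
  simp [v2]
  field_simp
  ring

/-- The invariant `ln (nⱼ / t) + t` is annihilated by `v2`. -/
theorem exists_hasFDerivAt_log_div_add {x : Space7} {j : Fin 3} (ht0 : 0 < x.1) (hn : 0 < x.2.2 j) :
    ∃ L : Space7 →L[ℝ] ℝ,
      HasFDerivAt (fun y : Space7 => Real.log (y.2.2 j / y.1) + y.1) L x ∧ L (v2 x) = 0 := by
  have ht : HasFDerivAt (fun y : Space7 => y.1) (ContinuousLinearMap.fst ℝ _ _) x :=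
    hasFDerivAt_fst
  have hnj : HasFDerivAt (fun y : Space7 => y.2.2 j) _ x :=
    hasFDerivAt_pi'.1 (hasFDerivAt_snd (𝕜 := ℝ) (p := x)).snd j
  simp only [div_eq_mul_inv]
  refine ⟨_, ((hnj.mul ((hasDerivAt_inv ht0.ne').comp_hasFDerivAt x ht)).log
    (mul_pos hn (inv_pos.2 ht0)).ne').add ht, ?_⟩
  have := hn.ne'
  have := ht0.ne'
  simp [v2]
  field_simp
  ring

/-- For differentiable `μ : ℝ⁶ → ℝ`, the function
`S(t,k,n) = μ(ln(k₁)−t, ln(k₂)−t, ln(k₃)−t, ln(n₁/t)+t, ln(n₂/t)+t, ln(n₃/t)+t)`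
satisfies `v₂[S] = 0` on the region where `t > 0`, all `kᵢ > 0` and all
`nⱼ > 0`. -/
theorem general_solution_v2 (μ : (Fin 6 → ℝ) → ℝ) (hμ : Differentiable ℝ μ) :
    ∀ x : Space7, 0 < x.1 →
      (∀ i : Fin 3, 0 < x.2.1 i) → (∀ j : Fin 3, 0 < x.2.2 j) →
      fderiv ℝ
        (fun y : Space7 =>
          μ ![Real.log (y.2.1 0) - y.1, Real.log (y.2.1 1) - y.1,
              Real.log (y.2.1 2) - y.1, Real.log (y.2.2 0 / y.1) + y.1,
              Real.log (y.2.2 1 / y.1) + y.1, Real.log (y.2.2 2 / y.1) + y.1])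
        x (v2 x) = 0 := by
  intro x ht hk hn
  obtain ⟨L₀, h₀, e₀⟩ := exists_hasFDerivAt_log_sub (hk 0)
  obtain ⟨L₁, h₁, e₁⟩ := exists_hasFDerivAt_log_sub (hk 1)
  obtain ⟨L₂, h₂, e₂⟩ := exists_hasFDerivAt_log_sub (hk 2)
  obtain ⟨L₃, h₃, e₃⟩ := exists_hasFDerivAt_log_div_add ht (hn 0)
  obtain ⟨L₄, h₄, e₄⟩ := exists_hasFDerivAt_log_div_add ht (hn 1)
  obtain ⟨L₅, h₅, e₅⟩ := exists_hasFDerivAt_log_div_add ht (hn 2)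
  have hI : HasFDerivAt
      (fun y : Space7 =>
        ![Real.log (y.2.1 0) - y.1, Real.log (y.2.1 1) - y.1,
          Real.log (y.2.1 2) - y.1, Real.log (y.2.2 0 / y.1) + y.1,
          Real.log (y.2.2 1 / y.1) + y.1, Real.log (y.2.2 2 / y.1) + y.1])
      (ContinuousLinearMap.pi ![L₀, L₁, L₂, L₃, L₄, L₅]) x := by
    rw [hasFDerivAt_pi']
    intro i
    fin_cases i
    exacts [h₀, h₁, h₂, h₃, h₄, h₅]
  have hv : ContinuousLinearMap.pi ![L₀, L₁, L₂, L₃, L₄, L₅] (v2 x) = 0 := by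
    ext i
    fin_cases i
    exacts [e₀, e₁, e₂, e₃, e₄, e₅]
  refine (DFunLike.congr_fun ((hμ _).hasFDerivAt.comp x hI).fderiv _).trans ?_
  rw [ContinuousLinearMap.comp_apply, hv, map_zero]
end
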